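/- Let 𝒜 be a minimally self-adjusting BST algorithm, p ∈ ℕ a constant, and f:ℕ→ℕ a function with log f(n) / log n → 0 as n → ∞ (i.e., f(n) = n^{o(1)}). Suppose that for every n, when 𝒜 is executed with initial tree the left-leaning path on [n] (n at the root and 1 at the deepest node) and access sequence 1, 2, …, n, every after-tree it creates can be partitioned into at most p monotone sets and has at most f(n) leaves. Then the total access cost C(n) of serving this sequence satisfies C(n)/n → ∞ as n → ∞; in particular, 𝒜 does not satisfy the sequential access theorem. -/

import Mathlib

namespace Paper

inductive BTree where
  | nil : BTree
  | node : BTree → ℕ → BTree → BTree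
deriving DecidableEq

namespace BTree

def keys : BTree → Finset ℕ
  | nil => ∅
  | node l x r => insert x (keys l ∪ keys r)

def root? : BTree → Option ℕ
  | nil => none
  | node _ x _ => some x

def isBST : BTree → Prop
  | nil => True
  | node l x r => (∀ y ∈ keys l, y < x) ∧ (∀ y ∈ keys r, x < y) ∧ isBST l ∧ isBST r

def subtree? (s : ℕ) : BTree → Option BTree
  | nil => none
  | node l x r => if s = x then some (node l x r) else if s < x then subtree? s l else subtree? s r

/-- The set of keys of the subtree rooted at `s` (∅ if `s` is not in the tree). -/
def subtreeKeys (T : BTree) (s : ℕ) : Finset ℕ := ((subtree? s T).map keys).getD ∅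

/-- The search path to `s`, listed from the root downwards. -/
def pathList (s : ℕ) : BTree → List ℕ
  | nil => []
  | node l x r => if s = x then [x] else if s < x then x :: pathList s l else x :: pathList s r

def pathSet (T : BTree) (s : ℕ) : Finset ℕ := (pathList s T).toFinset

def nodeDepth (s : ℕ) : BTree → ℕ
  | nil => 0
  | node l x r => if s = x then 0 else if s < x then nodeDepth s l + 1 else nodeDepth s r + 1

/-- Number of right-going edges on the path from the root to `s`. -/
def rightDepth (s : ℕ) : BTree → ℕ
  | nil => 0
  | node l x r => if s = x then 0 else if s < x then rightDepth s l else rightDepth s r + 1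

/-- Number of left-going edges on the path from the root to `s`. -/
def leftDepth (s : ℕ) : BTree → ℕ
  | nil => 0
  | node l x r => if s = x then 0 else if s < x then leftDepth s l + 1 else leftDepth s r

def leafCount : BTree → ℕ
  | nil => 0
  | node nil _ nil => 1
  | node l _ r => leafCount l + leafCount r

/-- The wing partition of a BST, each wing listed from its topmost node downwards. -/
def wings : BTree → List (List ℕ)
  | nil => []
  | node l x r =>
    match wings l with
    | [] => [x] :: wings r
    | wl :: rest => (x :: wl) :: (rest ++ wings r)

end BTree

open BTree

/-- The left-leaning path on `[n]`: `n` at the root, `1` at the deepest node. -/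
def leftPathTree : ℕ → BTree
  | 0 => BTree.nil
  | n + 1 => BTree.node (leftPathTree n) (n + 1) BTree.nil

/-- Number of side alternations (w.r.t. `s`) between adjacent elements of a list. -/
def sideAlt (s : ℕ) : List ℕ → ℕ
  | x :: y :: rest => (if (x < s ∧ s < y) ∨ (y < s ∧ s < x) then 1 else 0) + sideAlt s (y :: rest)
  | _ => 0

/-- The set of elements involved in side alternations (w.r.t. `s`) in a list. -/
def zigzagSet (s : ℕ) : List ℕ → Finset ℕ
  | x :: y :: rest =>
    (if (x < s ∧ s < y) ∨ (y < s ∧ s < x) then ({x, y} : Finset ℕ) else ∅) ∪ zigzagSet s (y :: rest)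
  | _ => ∅

noncomputable def wsum (w : ℕ → ℝ) (X : Finset ℕ) : ℝ := ∑ b ∈ X, w b

/-- Partial sum-of-logs potential of the set `X` in tree `T` (binary logarithm). -/
noncomputable def phiOn (w : ℕ → ℝ) (T : BTree) (X : Finset ℕ) : ℝ :=
  ∑ a ∈ X, Real.logb 2 (wsum w (subtreeKeys T a))

noncomputable def phiAll (w : ℕ → ℝ) (T : BTree) : ℝ := phiOn w T (keys T)

/-- A single access of a minimally self-adjusting BST algorithm: the accessed element `s`
becomes the root, the keys are unchanged, and every node off the search path keeps its
subtree; hence the search path is replaced by an after-tree rooted at `s` and the pendent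
subtrees are reattached in the unique order-preserving way. -/
structure IsAccess (T : BTree) (s : ℕ) (T' : BTree) : Prop where
  hT : isBST T
  hT' : isBST T'
  hs : s ∈ keys T
  hkeys : keys T' = keys T
  hroot : root? T' = some s
  hpendent : ∀ a ∈ keys T, a ∉ pathSet T s → subtree? a T' = subtree? a T

/-- The algorithm (viewed as the set of accesses it may perform) satisfies the access lemma
via the sum-of-logs potential. -/
def SatisfiesAL (Alg : BTree → ℕ → BTree → Prop) : Prop :=
  ∃ C : ℝ, 0 ≤ C ∧ ∀ T s T', Alg T s T' → ∀ w : ℕ → ℝ, (∀ i ∈ keys T, 0 < w i) →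
    ((pathSet T s).card : ℝ) ≤
      phiAll w T - phiAll w T' + C * (1 + Real.logb 2 (wsum w (keys T) / w s))

/-- `X` is subtree-disjoint (w.r.t. the tree after the access). -/
def SubtreeDisjoint (T' : BTree) (X : Finset ℕ) : Prop :=
  ∀ a ∈ X, ∀ b ∈ X, a ≠ b → subtreeKeys T' a ∩ subtreeKeys T' b = ∅

/-- `X` is monotone: all elements on one side of `s`, with equal right-depth
(resp. left-depth) in the after-tree.  (For nodes of the search path, depth in the
after-tree coincides with depth in `T'`.) -/
def IsMonotone (s : ℕ) (T' : BTree) (X : Finset ℕ) : Prop :=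
  ((∀ x ∈ X, s < x) ∧ ∃ d, ∀ x ∈ X, rightDepth x T' = d) ∨
  ((∀ x ∈ X, x < s) ∧ ∃ d, ∀ x ∈ X, leftDepth x T' = d)

/-- The after-tree minus its root can be partitioned into (at most) `k` monotone sets. -/
def MonotoneDecomp (T : BTree) (s : ℕ) (T' : BTree) (k : ℕ) : Prop :=
  ∃ M : Fin k → Finset ℕ,
    (∀ i, IsMonotone s T' (M i)) ∧
    (∀ i j, i ≠ j → Disjoint (M i) (M j)) ∧
    Finset.univ.biUnion M = pathSet T s \ {s}

/-- The leaves of the after-tree: path nodes having no path node as proper descendant in `T'`. -/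
def afterLeaves (T : BTree) (s : ℕ) (T' : BTree) : Finset ℕ :=
  (pathSet T s).filter (fun x => subtreeKeys T' x ∩ pathSet T s = {x})

/-- Rotate-to-root: `s` becomes the root and ancestor relations are otherwise preserved,
equivalently `T'(a) = T(a) ∩ (-∞,s)` for path nodes `a < s` and symmetrically for `a > s`. -/
def IsRotateToRoot (T : BTree) (s : ℕ) (T' : BTree) : Prop :=
  subtreeKeys T' s = keys T ∧
  ∀ a ∈ pathSet T s,
    (a < s → subtreeKeys T' a = (subtreeKeys T a).filter (fun b => b < s)) ∧
    (s < a → subtreeKeys T' a = (subtreeKeys T a).filter (fun b => s < b))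

def pendTree : Option ℕ → BTree
  | none => BTree.nil
  | some u => BTree.node BTree.nil u BTree.nil

def buildLeft (l : List (ℕ × Option ℕ)) : BTree :=
  l.foldl (fun t vc => BTree.node (pendTree vc.2) vc.1 t) BTree.nil

def buildRight (l : List (ℕ × Option ℕ)) : BTree :=
  l.foldl (fun t vc => BTree.node t vc.1 (pendTree vc.2)) BTree.nil

/-- Global view of splay: process the reversed search path `v₁, v₂, …` in pairs; if a pair
lies on the same side of `s`, the more ancestral element is removed from its path and
becomes a (pendant) child of the other.  Returns the two spines (elements `< s` and `> s`),
deepest first, each spine node with its optional pendant child. -/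
def splaySpines (s : ℕ) : List ℕ → List (ℕ × Option ℕ) × List (ℕ × Option ℕ)
  | [] => ([], [])
  | [v] => if v < s then ([(v, none)], []) else ([], [(v, none)])
  | v :: u :: rest =>
    let p := splaySpines s rest
    if v < s then
      if u < s then ((v, some u) :: p.1, p.2)
      else ((v, none) :: p.1, (u, none) :: p.2)
    else
      if u < s then ((u, none) :: p.1, (v, none) :: p.2)
      else (p.1, (v, some u) :: p.2)

/-- The after-tree of a splay access, built from the reversed search path without `s`. -/
def splayAfterTree (s : ℕ) (l : List ℕ) : BTree :=
  BTree.node (buildLeft (splaySpines s l).1) s (buildRight (splaySpines s l).2)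

/-- A splay access: a valid access whose after-tree (the restriction of `T'` to the search
path) is the splay after-tree. -/
def IsSplayAccess (T : BTree) (s : ℕ) (T' : BTree) : Prop :=
  IsAccess T s T' ∧
  ∀ x ∈ pathSet T s,
    subtreeKeys T' x ∩ pathSet T s = subtreeKeys (splayAfterTree s (pathList s T).reverse.tail) x

/-- A path-balance access: a valid access whose after-tree is a balanced BST of depth
`⌈log₂ (1 + |P|)⌉` rooted at `s`. -/
def IsPathBalanceAccess (T : BTree) (s : ℕ) (T' : BTree) : Prop :=
  IsAccess T s T' ∧
  ∀ x ∈ pathSet T s, nodeDepth x T' ≤ Nat.clog 2 (1 + (pathSet T s).card)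

def isParent (Q : BTree) (x y : ℕ) : Prop := pathList y Q = pathList x Q ++ [y]

/-- One step of a decomposition: a (descending) path `Pi` of `Q` is rearranged into a tree,
all other nodes keeping their subtrees. -/
def StepRel (Q Q' : BTree) (Pi : Finset ℕ) : Prop :=
  isBST Q' ∧ keys Q' = keys Q ∧
  (∃ l : List ℕ, l ≠ [] ∧ List.Chain' (isParent Q) l ∧ l.toFinset = Pi) ∧
  (∀ a ∈ keys Q, a ∉ Pi → subtree? a Q' = subtree? a Q)

/-- The transformation of the before-path `P0` (as a tree) into the after-tree `A` admits a
local decomposition with window size `wdw`. -/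
def HasLocalDecomp (s : ℕ) (P0 A : BTree) (wdw : ℕ) : Prop :=
  ∃ (k : ℕ) (Q : ℕ → BTree) (Ps : ℕ → Finset ℕ),
    1 ≤ k ∧ Q 0 = P0 ∧ Q k = A ∧
    (∀ i < k, StepRel (Q i) (Q (i + 1)) (Ps i)) ∧
    s ∈ Ps 0 ∧
    (∀ i, i + 1 < k → (Ps (i + 1) \ Ps i).Nonempty) ∧
    (∀ i, i + 1 < k → (Ps (i + 1) ∩ Ps i).Nonempty) ∧
    (∀ i j, i + 1 < j → j < k → Disjoint (Ps i \ Ps (i + 1)) (Ps j)) ∧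
    (∀ i < k, (Ps i).card ≤ wdw)

/-- The search path to `s` in `T`, as a tree (the before-path of the transformation). -/
def pathTree (s : ℕ) : BTree → BTree
  | BTree.nil => BTree.nil
  | BTree.node l x r =>
    if s = x then BTree.node BTree.nil x BTree.nil
    else if s < x then BTree.node (pathTree s l) x BTree.nil
    else BTree.node BTree.nil x (pathTree s r)

/-- `A` is the after-tree of the access `(T, s, T')`: the restriction of `T'` to the search path. -/
def IsAfterTree (T : BTree) (s : ℕ) (T' A : BTree) : Prop :=
  isBST A ∧ keys A = pathSet T s ∧
  ∀ x ∈ pathSet T s, subtreeKeys A x = subtreeKeys T' x ∩ pathSet T s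

/-- The algorithm is local with window size `wdw`. -/
def IsLocal (Alg : BTree → ℕ → BTree → Prop) (wdw : ℕ) : Prop :=
  ∀ T s T', Alg T s T' → ∀ A, IsAfterTree T s T' A → HasLocalDecomp s (pathTree s T) A wdw

open scoped Classical in
noncomputable def stair (n : ℕ) (h : ℕ → ℕ) (s : ℕ) : Finset ℕ :=
  (Finset.Icc 1 n).filter
    (fun b => ∀ b' ∈ Finset.Icc 1 n, ((s < b' ∧ b' < b) ∨ (b < b' ∧ b' < s)) → h b' < h b)

open scoped Classical in
noncomputable def nbhd (n : ℕ) (h : ℕ → ℕ) (a : ℕ) : Finset ℕ :=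
  (Finset.Icc 1 n).filter
    (fun b => ∀ b' ∈ Finset.Icc 1 n, b' ≠ a → min a b ≤ b' → b' ≤ max a b → h b' < h a)

/-- Geometric sum-of-logs partial potential. -/
noncomputable def phiGeo (n : ℕ) (h : ℕ → ℕ) (w : ℕ → ℝ) (X : Finset ℕ) : ℝ :=
  ∑ a ∈ X, Real.logb 2 (wsum w (nbhd n h a))

/-- `l` is (the reversal of) a valid search path to `s`, without `s`, deepest element first. -/
def ValidRevPath (s : ℕ) (l : List ℕ) : Prop :=
  l.Nodup ∧ s ∉ l ∧
  l.Pairwise (fun a b => (a < s → b < s → b < a) ∧ (s < a → s < b → a < b))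

end Paper

open Paper Paper.BTree

namespace Paper.BTree

theorem subtree?_keys_subset {s : ℕ} {T V : BTree} (h : subtree? s T = some V) :
    keys V ⊆ keys T := by
  induction T with
  | nil => simp [subtree?] at h
  | node l x r ihl ihr =>
    simp only [subtree?] at h
    split_ifs at h with h1 h2
    · simp_all
    · exact (ihl h).trans fun y hy => by simp [keys, hy]
    · exact (ihr h).trans fun y hy => by simp [keys, hy]

theorem mem_keys_of_subtree?_eq_some {s : ℕ} {T V : BTree} (h : subtree? s T = some V) :
    s ∈ keys V := by
  induction T with
  | nil => simp [subtree?] at h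
  | node l x r ihl ihr =>
    simp only [subtree?] at h
    split_ifs at h with h1 h2
    · simp only [Option.some.injEq] at h
      subst h
      simp [keys, h1]
    · exact ihl h
    · exact ihr h

theorem subtree?_eq_none {s : ℕ} {T : BTree} (h : s ∉ keys T) : subtree? s T = none := by
  rcases h' : subtree? s T with _ | V
  · rfl
  · exact absurd (subtree?_keys_subset h' (mem_keys_of_subtree?_eq_some h')) h

theorem mem_keys_of_mem_pathList {s y : ℕ} {T : BTree} (h : y ∈ pathList s T) : y ∈ keys T := by
  induction T with
  | nil => simp [pathList] at h
  | node l x r ihl ihr =>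
    simp only [pathList] at h
    split_ifs at h <;> simp only [List.mem_cons, List.not_mem_nil, or_false] at h <;>
      simp only [keys, Finset.mem_insert, Finset.mem_union] <;> tauto

theorem subtree?_node_left {a x : ℕ} {l r : BTree} (hT : isBST (node l x r)) (ha : a ∈ keys l) :
    subtree? a (node l x r) = subtree? a l := by
  have := hT.1 a ha
  simp [subtree?, this, this.ne]

theorem subtree?_node_right {a x : ℕ} {l r : BTree} (hT : isBST (node l x r)) (ha : a ∈ keys r) :
    subtree? a (node l x r) = subtree? a r := by
  have := hT.2.1 a ha
  simp [subtree?, this.not_gt, this.ne']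

/-- A node with a descendant on the search path to `s` is itself on that path. -/
theorem mem_pathList_of_subtree? {s x y : ℕ} {T V : BTree} (hT : isBST T)
    (hV : subtree? x T = some V) (hy : y ∈ keys V) (hys : y ∈ pathList s T) :
    x ∈ pathList s T := by
  induction T with
  | nil => simp [subtree?] at hV
  | node l z r ihl ihr =>
    obtain ⟨hl, hr, bl, br⟩ := hT
    simp only [subtree?] at hV
    simp only [pathList] at hys ⊢
    split_ifs at hV with h1 h2
    · split_ifs <;> simp [h1]
    · have hyl := hl y (subtree?_keys_subset hV hy)
      split_ifs at hys ⊢ with h3 h4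
      · simp at hys; omega
      · simp only [List.mem_cons] at hys ⊢
        exact Or.inr (ihl bl hV (hys.resolve_left hyl.ne))
      · simp only [List.mem_cons] at hys ⊢
        have := hr y (mem_keys_of_mem_pathList (hys.resolve_left hyl.ne))
        omega
    · have hyr := hr y (subtree?_keys_subset hV hy)
      split_ifs at hys ⊢ with h3 h4
      · simp at hys; omega
      · simp only [List.mem_cons] at hys ⊢
        have := hl y (mem_keys_of_mem_pathList (hys.resolve_left hyr.ne'))
        omega
      · simp only [List.mem_cons] at hys ⊢
        exact Or.inr (ihr br hV (hys.resolve_left hyr.ne'))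

/-! ### The wing potential -/

/-- The sum of `k log k` over the sizes `k` of the wings of a tree, where the topmost wing
is extended by `a` further nodes. -/
noncomputable def wingPot : BTree → ℕ → ℝ
  | nil, a => a * Real.log a
  | node l _ r, a => wingPot l (a + 1) + wingPot r 0

/-- The number of nonempty wings of a tree whose topmost wing is extended by `a` nodes. -/
def wingCount : BTree → ℕ → ℕ
  | nil, a => if a = 0 then 0 else 1
  | node l _ r, a => wingCount l (a + 1) + wingCount r 0

/-- The top part of a tree, consisting of nodes from `P`. -/
def cut (P : Finset ℕ) : BTree → BTree
  | nil => nil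
  | node l x r => if x ∈ P then node (cut P l) x (cut P r) else nil

/-- The subtrees hanging below the top part of a tree. -/
def pend (P : Finset ℕ) : BTree → List BTree
  | nil => []
  | node l x r => if x ∈ P then pend P l ++ pend P r else [node l x r]

/-- The number of nodes of a tree. -/
def size : BTree → ℕ
  | nil => 0
  | node l _ r => size l + size r + 1

theorem natCast_mul_log_add_le (a b : ℕ) :
    (a : ℝ) * Real.log a + b * Real.log b ≤ (a + b : ℕ) * Real.log (a + b : ℕ) := by
  have key : ∀ a b : ℕ, (a : ℝ) * Real.log a ≤ a * Real.log (a + b : ℕ) := by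
    intro a b
    rcases Nat.eq_zero_or_pos a with rfl | ha
    · simp
    · have : (0 : ℝ) < a := by exact_mod_cast ha
      have h2 : (a : ℝ) ≤ (a + b : ℕ) := by push_cast; linarith [(Nat.cast_nonneg b : (0 : ℝ) ≤ b)]
      gcongr
  have h1 := key a b
  have h2 := key b a
  rw [add_comm b a] at h2
  have : (a + b : ℕ) * Real.log (a + b : ℕ) =
      a * Real.log (a + b : ℕ) + b * Real.log (a + b : ℕ) := by push_cast; ring
  linarith

theorem add_wingPot_le (T : BTree) (a b : ℕ) :
    (a : ℝ) * Real.log a + wingPot T b ≤ wingPot T (a + b) := by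
  induction T generalizing b with
  | nil => exact natCast_mul_log_add_le a b
  | node l x r ihl ihr =>
    have := ihl (b + 1)
    simp only [wingPot, add_assoc] at *
    linarith

theorem wingPot_cut_add_pend_le (P : Finset ℕ) (T : BTree) (a : ℕ) :
    wingPot (cut P T) a + ((pend P T).map (wingPot · 0)).sum ≤ wingPot T a := by
  induction T generalizing a with
  | nil => simp [cut, pend]
  | node l x r ihl ihr =>
    by_cases hx : x ∈ P
    · have h1 := ihl (a + 1)
      have h2 := ihr 0
      simp only [cut, pend, hx, if_true, wingPot, List.map_append, List.sum_append]
      linarith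
    · have := add_wingPot_le (node l x r) a 0
      simp only [cut, pend, hx, if_false, List.map_cons, List.map_nil, List.sum_cons, List.sum_nil]
      simp only [add_zero] at this ⊢
      exact this

theorem wingPot_eq_of_min {s : ℕ} {T : BTree} (hT : isBST T) (hs : s ∈ keys T)
    (hmin : ∀ y ∈ keys T, s ≤ y) {P : Finset ℕ}
    (hP : ∀ x ∈ keys T, x ∈ P ↔ x ∈ pathList s T) (a : ℕ) :
    wingPot T a = ((pathList s T).length + a : ℕ) * Real.log ((pathList s T).length + a : ℕ) +
      ((pend P T).map (wingPot · 0)).sum := by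
  induction T generalizing a with
  | nil => simp [keys] at hs
  | node l x r ihl ihr =>
    obtain ⟨hl, hr, bl, br⟩ := hT
    have hxP : x ∈ P := by
      rw [hP x (by simp [keys])]
      simp only [pathList]; split_ifs <;> simp
    have hsx : s ≤ x := hmin x (by simp [keys])
    have hpr : ((pend P r).map (wingPot · 0)).sum = wingPot r 0 := by
      rcases r with _ | ⟨r1, y, r2⟩
      · simp [pend, wingPot]
      · have hy : y ∉ P := by
          rw [hP y (by simp [keys])]
          have hxy := hr y (by simp [keys])
          simp only [pathList]
          split_ifs with h1 h2
          · simp; omega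
          · simp only [List.mem_cons, not_or]
            exact ⟨by omega, fun h => by have := hl y (mem_keys_of_mem_pathList h); omega⟩
          all_goals omega
        simp [pend, hy]
    simp only [wingPot, pend, hxP, if_true, List.map_append, List.sum_append, hpr]
    rcases hsx.eq_or_lt with rfl | hlt
    · have hln : l = nil := by
        rcases l with _ | ⟨l1, y, l2⟩
        · rfl
        · have h1 := hl y (by simp [keys])
          have h2 := hmin y (by simp [keys])
          omega
      subst hln
      simp [pend, wingPot, pathList, add_comm]
    · have hsl : s ∈ keys l := by
        simp only [keys, Finset.mem_insert, Finset.mem_union] at hs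
        rcases hs with h | h | h
        · omega
        · exact h
        · have := hr s h; omega
      have := ihl bl hsl (fun y hy => hmin y (by simp [keys, hy])) (fun y hy => by
        rw [hP y (by simp [keys, hy])]
        have := hl y hy
        simp [pathList, hlt.ne, hlt, this.ne]) (a + 1)
      rw [this]
      simp only [pathList, hlt.ne, hlt, if_true, if_false, List.length_cons]
      rw [show (pathList s l).length + (a + 1) = (pathList s l).length + 1 + a by ring]
      ring

theorem exists_subtree?_of_mem_pend {P : Finset ℕ} {T V : BTree} (hT : isBST T)
    (hV : V ∈ pend P T) : ∃ a, a ∉ P ∧ subtree? a T = some V := by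
  induction T with
  | nil => simp [pend] at hV
  | node l x r ihl ihr =>
    simp only [pend] at hV
    split_ifs at hV with hx
    · rw [List.mem_append] at hV
      rcases hV with h | h
      · obtain ⟨a, ha, h⟩ := ihl hT.2.2.1 h
        refine ⟨a, ha, ?_⟩
        rw [subtree?_node_left hT, h]
        exact subtree?_keys_subset h (mem_keys_of_subtree?_eq_some h)
      · obtain ⟨a, ha, h⟩ := ihr hT.2.2.2 h
        refine ⟨a, ha, ?_⟩
        rw [subtree?_node_right hT, h]
        exact subtree?_keys_subset h (mem_keys_of_subtree?_eq_some h)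
    · simp only [List.mem_singleton] at hV
      exact ⟨x, hx, by simp [subtree?, hV]⟩

theorem eq_or_size_lt_of_subtree? {a : ℕ} {T V : BTree} (h : subtree? a T = some V) :
    V = T ∨ size V < size T := by
  induction T with
  | nil => simp [subtree?] at h
  | node l x r ihl ihr =>
    simp only [subtree?] at h
    split_ifs at h
    · left; simpa using h.symm
    · right
      rcases ihl h with rfl | h <;> simp only [size] <;> omega
    · right
      rcases ihr h with rfl | h <;> simp only [size] <;> omega

theorem exists_mem_pend_of_subtree? {P : Finset ℕ} {a : ℕ} {T V : BTree} (ha : a ∉ P)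
    (h : subtree? a T = some V) :
    ∃ W ∈ pend P T, keys V ⊆ keys W ∧ (V = W ∨ size V < size W) := by
  induction T with
  | nil => simp [subtree?] at h
  | node l x r ihl ihr =>
    simp only [pend]
    split_ifs with hx
    · simp only [subtree?] at h
      split_ifs at h with h1 h2
      · exact absurd (h1 ▸ hx) ha
      · obtain ⟨W, hW, h⟩ := ihl h
        exact ⟨W, by simp [hW], h⟩
      · obtain ⟨W, hW, h⟩ := ihr h
        exact ⟨W, by simp [hW], h⟩
    · exact ⟨_, by simp, subtree?_keys_subset h, eq_or_size_lt_of_subtree? h⟩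

theorem keys_subset_of_mem_pend {P : Finset ℕ} {T V : BTree} (hT : isBST T)
    (hV : V ∈ pend P T) : keys V ⊆ keys T := by
  obtain ⟨a, -, h⟩ := exists_subtree?_of_mem_pend hT hV
  exact subtree?_keys_subset h

theorem pend_pairwise_disjoint {P : Finset ℕ} {T : BTree} (hT : isBST T) :
    (pend P T).Pairwise fun V W => Disjoint (keys V) (keys W) := by
  induction T with
  | nil => simp [pend]
  | node l x r ihl ihr =>
    obtain ⟨hl, hr, bl, br⟩ := hT
    simp only [pend]
    split_ifs
    · rw [List.pairwise_append]
      refine ⟨ihl bl, ihr br, fun V hV W hW => ?_⟩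
      rw [Finset.disjoint_left]
      intro y hy hy'
      have h1 := hl y (keys_subset_of_mem_pend bl hV hy)
      have h2 := hr y (keys_subset_of_mem_pend br hW hy')
      omega
    · simp

theorem keys_nonempty_of_mem_pend {P : Finset ℕ} {T V : BTree} (hT : isBST T)
    (hV : V ∈ pend P T) : (keys V).Nonempty := by
  obtain ⟨a, -, h⟩ := exists_subtree?_of_mem_pend hT hV
  exact ⟨a, mem_keys_of_subtree?_eq_some h⟩

theorem pend_nodup {P : Finset ℕ} {T : BTree} (hT : isBST T) : (pend P T).Nodup := by
  refine (pend_pairwise_disjoint (P := P) hT).imp_of_mem ?_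
  rintro V W hV - h rfl
  exact (keys_nonempty_of_mem_pend hT hV).ne_empty (disjoint_self.1 h)

theorem eq_of_mem_pend {P : Finset ℕ} {T V W : BTree} (hT : isBST T) (hV : V ∈ pend P T)
    (hW : W ∈ pend P T) (h : ¬ Disjoint (keys V) (keys W)) : V = W := by
  by_contra hne
  have : Std.Symm fun V W : BTree => Disjoint (keys V) (keys W) := ⟨fun _ _ h => h.symm⟩
  exact h ((pend_pairwise_disjoint hT).forall hV hW hne)

theorem pend_subset {P : Finset ℕ} {T T' : BTree} (hT : isBST T) (hT' : isBST T')
    (h : ∀ a, a ∉ P → subtree? a T' = subtree? a T) {V : BTree} (hV : V ∈ pend P T) :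
    V ∈ pend P T' := by
  obtain ⟨a, ha, hVa⟩ := exists_subtree?_of_mem_pend hT hV
  obtain ⟨W, hW, hVW, hVW'⟩ := exists_mem_pend_of_subtree? ha ((h a ha).trans hVa)
  obtain ⟨b, hb, hWb⟩ := exists_subtree?_of_mem_pend hT' hW
  obtain ⟨U, hU, hWU, hWU'⟩ := exists_mem_pend_of_subtree? hb ((h b hb).symm.trans hWb)
  have haV := mem_keys_of_subtree?_eq_some hVa
  have : V = U := eq_of_mem_pend hT hV hU
    (Finset.not_disjoint_iff.2 ⟨a, haV, hWU (hVW haV)⟩)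
  subst this
  rcases hVW' with rfl | h1
  · exact hW
  · rcases hWU' with rfl | h2
    · exact hW
    · omega

theorem pend_perm {P : Finset ℕ} {T T' : BTree} (hT : isBST T) (hT' : isBST T')
    (h : ∀ a, a ∉ P → subtree? a T' = subtree? a T) : (pend P T).Perm (pend P T') :=
  (List.perm_ext_iff_of_nodup (pend_nodup hT) (pend_nodup hT')).2 fun _ =>
    ⟨pend_subset hT hT' h, pend_subset hT' hT fun a ha => (h a ha).symm⟩

/-! ### The top part of a tree -/

theorem keys_cut_subset (P : Finset ℕ) (T : BTree) : keys (cut P T) ⊆ keys T := by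
  induction T with
  | nil => simp [cut]
  | node l x r ihl ihr =>
    simp only [cut]
    split_ifs
    · exact Finset.insert_subset_insert _ (Finset.union_subset_union ihl ihr)
    · simp [keys]

theorem isBST_cut {P : Finset ℕ} {T : BTree} (hT : isBST T) : isBST (cut P T) := by
  induction T with
  | nil => simp [cut, isBST]
  | node l x r ihl ihr =>
    simp only [cut]
    split_ifs
    · exact ⟨fun y hy => hT.1 y (keys_cut_subset P l hy),
        fun y hy => hT.2.1 y (keys_cut_subset P r hy), ihl hT.2.2.1, ihr hT.2.2.2⟩
    · trivial

/-- Nodes outside `P` have no descendants in `P`. -/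
def UpClosed (P : Finset ℕ) (T : BTree) : Prop :=
  ∀ x V, x ∉ P → subtree? x T = some V → Disjoint (keys V) P

theorem UpClosed.left {P : Finset ℕ} {x : ℕ} {l r : BTree} (hT : isBST (node l x r))
    (h : UpClosed P (node l x r)) : UpClosed P l := fun y V hy hV =>
  h y V hy (by
    rw [subtree?_node_left hT, hV]
    exact subtree?_keys_subset hV (mem_keys_of_subtree?_eq_some hV))

theorem UpClosed.right {P : Finset ℕ} {x : ℕ} {l r : BTree} (hT : isBST (node l x r))
    (h : UpClosed P (node l x r)) : UpClosed P r := fun y V hy hV =>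
  h y V hy (by
    rw [subtree?_node_right hT, hV]
    exact subtree?_keys_subset hV (mem_keys_of_subtree?_eq_some hV))

theorem keys_cut {P : Finset ℕ} {T : BTree} (hT : isBST T) (h : UpClosed P T) :
    keys (cut P T) = keys T ∩ P := by
  induction T with
  | nil => simp [cut, keys]
  | node l x r ihl ihr =>
    simp only [cut]
    split_ifs with hx
    · simp only [keys, ihl hT.2.2.1 (h.left hT), ihr hT.2.2.2 (h.right hT)]
      rw [Finset.insert_inter_of_mem hx, Finset.union_inter_distrib_right]
    · exact (Finset.disjoint_iff_inter_eq_empty.1 (h x _ hx (by simp [subtree?]))).symm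

theorem rightDepth_node_left {a x : ℕ} {l r : BTree} (h : a < x) :
    rightDepth a (node l x r) = rightDepth a l := by
  simp [rightDepth, h, h.ne]

theorem rightDepth_node_right {a x : ℕ} {l r : BTree} (h : x < a) :
    rightDepth a (node l x r) = rightDepth a r + 1 := by
  simp [rightDepth, h.not_gt, h.ne']

theorem rightDepth_cut {P : Finset ℕ} {T : BTree} (hT : isBST T) {x : ℕ}
    (hx : x ∈ keys (cut P T)) : rightDepth x (cut P T) = rightDepth x T := by
  induction T with
  | nil => rfl
  | node l y r ihl ihr =>
    simp only [cut] at hx ⊢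
    split_ifs at hx ⊢ with hy
    · simp only [keys, Finset.mem_insert, Finset.mem_union] at hx
      rcases hx with rfl | hx | hx
      · simp [rightDepth]
      · have := hT.1 x (keys_cut_subset P l hx)
        rw [rightDepth_node_left this, rightDepth_node_left this, ihl hT.2.2.1 hx]
      · have := hT.2.1 x (keys_cut_subset P r hx)
        rw [rightDepth_node_right this, rightDepth_node_right this, ihr hT.2.2.2 hx]
    · simp [keys] at hx

/-- The set of leaves of a tree. -/
def leafSet : BTree → Finset ℕ
  | nil => ∅
  | node l x r => if l = nil ∧ r = nil then {x} else leafSet l ∪ leafSet r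

theorem leafSet_subset_keys (T : BTree) : leafSet T ⊆ keys T := by
  induction T with
  | nil => simp [leafSet]
  | node l x r ihl ihr =>
    simp only [leafSet, keys]
    split_ifs
    · simp
    · exact (Finset.union_subset_union ihl ihr).trans (Finset.subset_insert _ _)

theorem subtreeKeys_inter_of_mem_leafSet_cut {P : Finset ℕ} {T : BTree} (hT : isBST T)
    (h : UpClosed P T) {x : ℕ} (hx : x ∈ leafSet (cut P T)) : subtreeKeys T x ∩ P = {x} := by
  induction T with
  | nil => simp [cut, leafSet] at hx
  | node l y r ihl ihr =>
    have hk := keys_cut hT h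
    by_cases hy : y ∈ P
    · simp only [cut, hy, if_true, leafSet] at hx hk
      split_ifs at hx with hn
      · simp only [Finset.mem_singleton] at hx
        subst hx
        simp only [hn.1, hn.2, keys] at hk
        simpa [subtreeKeys, subtree?, keys] using hk.symm
      · rw [Finset.mem_union] at hx
        rcases hx with hx | hx
        · have hxl := keys_cut_subset P l (leafSet_subset_keys _ hx)
          rw [← ihl hT.2.2.1 (h.left hT) hx, subtreeKeys, subtree?_node_left hT hxl, subtreeKeys]
        · have hxr := keys_cut_subset P r (leafSet_subset_keys _ hx)
          rw [← ihr hT.2.2.2 (h.right hT) hx, subtreeKeys, subtree?_node_right hT hxr, subtreeKeys]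
    · simp [cut, hy, leafSet] at hx

/-- The maximal right-depth of a node. -/
def maxRightDepth : BTree → ℕ
  | nil => 0
  | node l _ r => max (maxRightDepth l) (if r = nil then 0 else maxRightDepth r + 1)

theorem exists_rightDepth_eq {T : BTree} (hT : isBST T) (hne : T ≠ nil) {d : ℕ}
    (hd : d ≤ maxRightDepth T) : ∃ x ∈ keys T, rightDepth x T = d := by
  induction T generalizing d with
  | nil => exact absurd rfl hne
  | node l x r ihl ihr =>
    rcases Nat.eq_zero_or_pos d with rfl | hd0
    · exact ⟨x, by simp [keys], by simp [rightDepth]⟩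
    simp only [maxRightDepth, le_max_iff] at hd
    rcases hd with hd | hd
    · have hl : l ≠ nil := by rintro rfl; simp [maxRightDepth] at hd; omega
      obtain ⟨y, hy, h⟩ := ihl hT.2.2.1 hl hd
      exact ⟨y, by simp [keys, hy], by rw [rightDepth_node_left (hT.1 y hy), h]⟩
    · split_ifs at hd with hr
      · omega
      · obtain ⟨y, hy, h⟩ := ihr hT.2.2.2 hr (d := d - 1) (by omega)
        exact ⟨y, by simp [keys, hy], by rw [rightDepth_node_right (hT.2.1 y hy), h]; omega⟩

theorem wingCount_le {T : BTree} (hT : isBST T) (hne : T ≠ nil) (a : ℕ) :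
    wingCount T a ≤ (maxRightDepth T + 1) * (leafSet T).card := by
  induction T generalizing a with
  | nil => exact absurd rfl hne
  | node l x r ihl ihr =>
    obtain ⟨hl, hr, bl, br⟩ := hT
    have hdisj : Disjoint (leafSet l) (leafSet r) := by
      rw [Finset.disjoint_left]
      intro y h1 h2
      have := hl y (leafSet_subset_keys l h1)
      have := hr y (leafSet_subset_keys r h2)
      omega
    have hL : l ≠ nil → wingCount l (a + 1) ≤ (maxRightDepth (node l x r) + 1) *
        (leafSet l).card := fun h =>
      (ihl bl h (a + 1)).trans (Nat.mul_le_mul_right _ (by simp [maxRightDepth]))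
    have hR : r ≠ nil → wingCount r 0 ≤ maxRightDepth (node l x r) * (leafSet r).card := fun h =>
      (ihr br h 0).trans (Nat.mul_le_mul_right _ (by simp [maxRightDepth, h]))
    have hpos : r ≠ nil → 0 < (leafSet r).card := by
      intro h
      by_contra h0
      have h0 : (leafSet r).card = 0 := by omega
      have := ihr br h 1
      rw [h0] at this
      have h1 : ∀ (U : BTree) b, 0 < wingCount U (b + 1) := by
        intro U
        induction U with
        | nil => simp [wingCount]
        | node _ _ _ ih _ => intro b; have := ih (b + 1); simp only [wingCount]; omega
      have := h1 r 0
      simp at *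
      omega
    simp only [wingCount, leafSet]
    generalize maxRightDepth (node l x r) = d at *
    split_ifs with hn
    · simp [hn.1, hn.2, wingCount]
    · rw [Finset.card_union_of_disjoint hdisj, mul_add]
      by_cases h1 : l = nil
      · have h2 : r ≠ nil := fun h => hn ⟨h1, h⟩
        have := hR h2
        have := hpos h2
        simp only [h1, wingCount]
        simp
        nlinarith
      · by_cases h2 : r = nil
        · have := hL h1
          simp only [h2, wingCount]
          simp
          omega
        · have := hR h2
          have := hL h1
          nlinarith

theorem le_wingPot {q : ℝ} (hq : 0 < q) {T : BTree} (hT : isBST T) (a : ℕ) :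
    ((keys T).card + a) * (Real.log q + 1) - q * wingCount T a ≤ wingPot T a := by
  induction T generalizing a with
  | nil =>
    rcases Nat.eq_zero_or_pos a with rfl | ha
    · simp [keys, wingCount, wingPot]
    · have ha' : (0 : ℝ) < a := by exact_mod_cast ha
      simp only [keys, wingCount, wingPot, ha.ne', if_false, Finset.card_empty]
      have h1 := Real.log_le_sub_one_of_pos (div_pos hq ha')
      rw [Real.log_div hq.ne' ha'.ne'] at h1
      have h2 := mul_le_mul_of_nonneg_left h1 ha'.le
      have h3 : (a : ℝ) * (q / a - 1) = q - a := by field_simp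
      push_cast
      nlinarith
  | node l x r ihl ihr =>
    obtain ⟨hl, hr, bl, br⟩ := hT
    have h1 := ihl bl (a + 1)
    have h2 := ihr br 0
    have hc : (keys (node l x r)).card = (keys l).card + (keys r).card + 1 := by
      simp only [keys]
      rw [Finset.card_insert_of_notMem, Finset.card_union_of_disjoint]
      · rw [Finset.disjoint_left]
        intro y h1 h2
        have := hl y h1
        have := hr y h2
        omega
      · rw [Finset.mem_union]
        rintro (h | h)
        · exact (hl x h).false
        · exact (hr x h).false
    rw [hc]
    simp only [wingCount, wingPot]
    push_cast at *
    nlinarith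

theorem pathList_nodup {s : ℕ} {T : BTree} (hT : isBST T) : (pathList s T).Nodup := by
  induction T with
  | nil => simp [pathList]
  | node l x r ihl ihr =>
    obtain ⟨hl, hr, bl, br⟩ := hT
    simp only [pathList]
    split_ifs
    · simp
    · exact List.nodup_cons.2 ⟨fun h => (hl x (mem_keys_of_mem_pathList h)).false, ihl bl⟩
    · exact List.nodup_cons.2 ⟨fun h => (hr x (mem_keys_of_mem_pathList h)).false, ihr br⟩

theorem mem_pathList_self {s : ℕ} {T : BTree} (hT : isBST T) (hs : s ∈ keys T) :
    s ∈ pathList s T := by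
  induction T with
  | nil => simp [keys] at hs
  | node l x r ihl ihr =>
    obtain ⟨hl, hr, bl, br⟩ := hT
    simp only [keys, Finset.mem_insert, Finset.mem_union] at hs
    simp only [pathList]
    split_ifs with h1 h2
    · simp [h1]
    · refine List.mem_cons_of_mem _ (ihl bl ?_)
      rcases hs with h | h | h
      · exact absurd h h1
      · exact h
      · have := hr s h; omega
    · refine List.mem_cons_of_mem _ (ihr br ?_)
      rcases hs with h | h | h
      · exact absurd h h1
      · have := hl s h; omega
      · exact h

/-- Rearranging the left spine of a tree into at most `m` wings, and removing its minimum,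
decreases the wing potential by at most `k (log m + 1)`, where `k` is the spine length. -/
theorem wingPot_le_add {R R' : BTree} {P : Finset ℕ} {s m : ℕ} (hR : isBST R) (hR' : isBST R')
    (hs : s ∈ keys R) (hmin : ∀ y ∈ keys R, s ≤ y) (hk : keys R' = (keys R).erase s)
    (hP : ∀ x ∈ keys R, x ∈ P ↔ x ∈ pathList s R)
    (hsub : ∀ a, a ∉ P → subtree? a R' = subtree? a R)
    (hcl : UpClosed P R')
    (hm : 1 ≤ m) (hw : wingCount (cut P R') 0 ≤ m) :
    wingPot R 0 ≤ wingPot R' 0 + (pathList s R).length * (Real.log m + 1) := by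
  have h1 := wingPot_eq_of_min hR hs hmin hP 0
  have h2 := wingPot_cut_add_pend_le P R' 0
  have h3 : ((pend P R).map (wingPot · 0)).sum = ((pend P R').map (wingPot · 0)).sum :=
    ((pend_perm hR hR' hsub).map _).sum_eq
  have hsP := mem_pathList_self hR hs
  have hcard : (keys (cut P R')).card + 1 = (pathList s R).length := by
    rw [keys_cut hR' hcl, ← List.toFinset_card_of_nodup (pathList_nodup hR), hk,
      ← Finset.card_erase_add_one (List.mem_toFinset.2 hsP)]
    congr 2
    ext y
    simp only [Finset.mem_inter, Finset.mem_erase, List.mem_toFinset]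
    constructor
    · rintro ⟨⟨h, h'⟩, h''⟩
      exact ⟨h, (hP y h').1 h''⟩
    · rintro ⟨h, h'⟩
      have := mem_keys_of_mem_pathList h'
      exact ⟨⟨h, this⟩, (hP y this).2 h'⟩
  have hk0 : 0 < (pathList s R).length := by omega
  generalize (pathList s R).length = k at *
  have hkr : (0 : ℝ) < k := by exact_mod_cast hk0
  have hmr : (1 : ℝ) ≤ m := by exact_mod_cast hm
  have hm0 : (0 : ℝ) < m := by linarith
  have h4 := le_wingPot (div_pos hkr hm0) (isBST_cut (P := P) hR') 0
  have h5 : ((keys (cut P R')).card : ℝ) = k - 1 := by rw [← hcard]; push_cast; ring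
  have h6 : (k : ℝ) / m * wingCount (cut P R') 0 ≤ k := by
    have : (wingCount (cut P R') 0 : ℝ) ≤ m := by exact_mod_cast hw
    calc (k : ℝ) / m * wingCount (cut P R') 0 ≤ k / m * m := by gcongr
      _ = k := by field_simp
  rw [h5, Real.log_div hkr.ne' hm0.ne'] at h4
  have h7 := Real.log_le_sub_one_of_pos hkr
  have h8 := Real.log_nonneg hmr
  simp only [add_zero, Nat.cast_zero] at *
  nlinarith

/-! ### A single sequential access -/

theorem eq_nil_of_keys_eq_empty {T : BTree} (h : keys T = ∅) : T = nil := by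
  rcases T with _ | ⟨l, x, r⟩
  · rfl
  · simp [keys] at h

theorem wingPot_leftPathTree (n a : ℕ) :
    wingPot (leftPathTree n) a = (n + a : ℕ) * Real.log (n + a : ℕ) := by
  induction n generalizing a with
  | zero => simp [leftPathTree, wingPot]
  | succ n ih =>
    simp only [leftPathTree, wingPot, ih]
    rw [show n + (a + 1) = n + 1 + a by ring]
    simp

theorem keys_leftPathTree (n : ℕ) : keys (leftPathTree n) = Finset.Icc 1 n := by
  induction n with
  | zero => simp [leftPathTree, keys]
  | succ n ih =>
    ext y
    simp only [leftPathTree, keys, ih, Finset.mem_insert, Finset.mem_union, Finset.mem_Icc,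
      Finset.notMem_empty, or_false]
    omega

theorem isBST_leftPathTree (n : ℕ) : isBST (leftPathTree n) := by
  induction n with
  | zero => trivial
  | succ n ih =>
    refine ⟨fun y hy => ?_, by simp [keys], ih, trivial⟩
    rw [keys_leftPathTree, Finset.mem_Icc] at hy
    omega

theorem card_image_rightDepth_le {T T' : BTree} {s p : ℕ} (h : MonotoneDecomp T s T' p)
    {X : Finset ℕ} (hX : X ⊆ pathSet T s) (hs : ∀ x ∈ X, s < x) :
    (X.image (rightDepth · T')).card ≤ p := by
  obtain ⟨M, hM, -, hU⟩ := h
  have : ∀ i, ∃ d, ∀ x ∈ M i, s < x → rightDepth x T' = d := by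
    intro i
    rcases hM i with ⟨-, d, hd⟩ | ⟨h, -⟩
    · exact ⟨d, fun x hx _ => hd x hx⟩
    · exact ⟨0, fun x hx hx' => absurd hx' (h x hx).not_gt⟩
  choose d hd using this
  calc (X.image (rightDepth · T')).card ≤ (Finset.univ.image d).card := by
        refine Finset.card_le_card fun y hy => ?_
        obtain ⟨x, hx, rfl⟩ := Finset.mem_image.1 hy
        have hxU : x ∈ Finset.univ.biUnion M := by
          rw [hU]
          simp [hX hx, (hs x hx).ne']
        obtain ⟨i, -, hi⟩ := Finset.mem_biUnion.1 hxU
        exact Finset.mem_image.2 ⟨i, Finset.mem_univ i, (hd i x hi (hs x hx)).symm⟩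
    _ ≤ (Finset.univ : Finset (Fin p)).card := Finset.card_image_le
    _ = p := by simp

theorem wingCount_cut_le {T L' R' : BTree} {s p : ℕ} (hT' : isBST (node L' s R'))
    (hcl : UpClosed (pathSet T s) R') (hmono : MonotoneDecomp T s (node L' s R') p) :
    wingCount (cut (pathSet T s) R') 0 ≤ p * (afterLeaves T s (node L' s R')).card := by
  set P := pathSet T s with hPdef
  have hR' := hT'.2.2.2
  by_cases hne : cut P R' = nil
  · simp [hne, wingCount]
  have hA := isBST_cut (P := P) hR'
  have hkA : keys (cut P R') ⊆ P := by
    rw [keys_cut hR' hcl]; exact Finset.inter_subset_right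
  have hgt : ∀ x ∈ keys (cut P R'), s < x := fun x hx => hT'.2.1 x (keys_cut_subset P R' hx)
  have hd : maxRightDepth (cut P R') + 1 ≤ p := by
    refine le_trans ?_ (card_image_rightDepth_le hmono hkA hgt)
    rw [← Finset.card_range (maxRightDepth (cut P R') + 1),
      ← Finset.card_image_of_injective _ (add_left_injective 1)]
    refine Finset.card_le_card fun y hy => ?_
    obtain ⟨d, hd, rfl⟩ := Finset.mem_image.1 hy
    obtain ⟨x, hx, hxd⟩ := exists_rightDepth_eq hA hne (Nat.lt_succ_iff.1 (Finset.mem_range.1 hd))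
    refine Finset.mem_image.2 ⟨x, hx, ?_⟩
    rw [rightDepth_node_right (hgt x hx), ← rightDepth_cut hR' hx, hxd]
  have hl : leafSet (cut P R') ⊆ afterLeaves T s (node L' s R') := by
    intro x hx
    have hxA := leafSet_subset_keys _ hx
    refine Finset.mem_filter.2 ⟨hkA hxA, ?_⟩
    rw [← subtreeKeys_inter_of_mem_leafSet_cut hR' hcl hx, subtreeKeys,
      subtree?_node_right hT' (keys_cut_subset P R' hxA), subtreeKeys]
  exact (wingCount_le hA hne 0).trans (Nat.mul_le_mul hd (Finset.card_le_card hl))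

theorem upClosed_pathSet {T : BTree} (hT : isBST T) (s : ℕ) : UpClosed (pathSet T s) T := by
  intro x V hx hV
  rw [Finset.disjoint_left]
  intro y hy hy'
  exact hx (List.mem_toFinset.2 (mem_pathList_of_subtree? hT hV hy (List.mem_toFinset.1 hy')))

/-- The right subtree of a tree. -/
def rightTree : BTree → BTree
  | nil => nil
  | node _ _ r => r

theorem exists_eq_node_of_root? {T : BTree} {s : ℕ} (h : root? T = some s) :
    ∃ l r, T = node l s r := by
  rcases T with _ | ⟨l, x, r⟩
  · simp [root?] at h
  · simp only [root?, Option.some.injEq] at h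
    exact ⟨l, r, by rw [h]⟩

/-- The change of potential in an access to the minimum `s` of a subtree `R`, where `R` is
either the whole tree or the right subtree. -/
theorem wingPot_access {T T' R : BTree} {s p m : ℕ} (hacc : IsAccess T s T')
    (hmono : MonotoneDecomp T s T' p) (hm : 1 ≤ m)
    (hle : p * (afterLeaves T s T').card ≤ m) (hR : isBST R) (hs : s ∈ keys R)
    (hkR : ∀ y, y ∈ keys R ↔ y ∈ keys T ∧ s ≤ y)
    (hpath : ∀ x ∈ keys R, x ∈ pathList s T ↔ x ∈ pathList s R)
    (hsubR : ∀ a ∈ keys R, subtree? a T = subtree? a R) :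
    wingPot R 0 ≤ wingPot (rightTree T') 0 + (pathSet T s).card * (Real.log m + 1) := by
  obtain ⟨L', R', rfl⟩ := exists_eq_node_of_root? hacc.hroot
  have hT' := hacc.hT'
  have hk : keys R' = (keys R).erase s := by
    ext y
    rw [Finset.mem_erase, hkR, ← hacc.hkeys]
    simp only [keys, Finset.mem_insert, Finset.mem_union]
    constructor
    · intro h
      have := hT'.2.1 y h
      exact ⟨by omega, by tauto, by omega⟩
    · rintro ⟨h1, h2 | h2 | h2, h3⟩
      · exact absurd h2 h1
      · have := hT'.1 y h2; omega
      · exact h2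
  have hsP : s ∈ pathSet T s := List.mem_toFinset.2 (mem_pathList_self hacc.hT hacc.hs)
  have hsub : ∀ a, a ∉ pathSet T s → subtree? a R' = subtree? a R := by
    intro a ha
    by_cases haR : a ∈ keys R
    · have haR' : a ∈ keys R' := by
        rw [hk, Finset.mem_erase]
        exact ⟨fun h => ha (h ▸ hsP), haR⟩
      rw [← subtree?_node_right hT' haR', hacc.hpendent a ((hkR a).1 haR).1 ha, hsubR a haR]
    · rw [subtree?_eq_none haR, subtree?_eq_none]
      rw [hk, Finset.mem_erase]
      exact fun h => haR h.2
  have hcl : UpClosed (pathSet T s) R' := by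
    intro x V hx hV
    rw [hsub x hx] at hV
    refine upClosed_pathSet hacc.hT s x V hx ?_
    rw [hsubR x (subtree?_keys_subset hV (mem_keys_of_subtree?_eq_some hV)), hV]
  have hP : ∀ x ∈ keys R, x ∈ pathSet T s ↔ x ∈ pathList s R := fun x hx => by
    rw [pathSet, List.mem_toFinset, hpath x hx]
  have hmain := wingPot_le_add hR hT'.2.2.2 hs (fun y hy => ((hkR y).1 hy).2) hk
    hP hsub hcl hm ((wingCount_cut_le hT' hcl hmono).trans hle)
  have hlen : (pathList s R).length ≤ (pathSet T s).card := by
    rw [← List.toFinset_card_of_nodup (pathList_nodup hR)]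
    refine Finset.card_le_card fun y hy => ?_
    rw [List.mem_toFinset] at hy
    exact (hP y (mem_keys_of_mem_pathList hy)).2 hy
  have hlog : (0 : ℝ) ≤ Real.log m := Real.log_nonneg (by exact_mod_cast hm)
  have : ((pathList s R).length : ℝ) ≤ (pathSet T s).card := by exact_mod_cast hlen
  simp only [rightTree]
  nlinarith

/-- The part of the tree that has not been accessed after the accesses `1, …, i`. -/
def remaining : ℕ → BTree → BTree
  | 0, T => T
  | _ + 1, T => rightTree T

theorem wingPot_sequential_access {T T' : BTree} {n i p m : ℕ} (hacc : IsAccess T (i + 1) T')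
    (hkT : keys T = Finset.Icc 1 n) (hroot : i ≠ 0 → root? T = some i)
    (hmono : MonotoneDecomp T (i + 1) T' p) (hm : 1 ≤ m)
    (hle : p * (afterLeaves T (i + 1) T').card ≤ m) :
    wingPot (remaining i T) 0 ≤
      wingPot (remaining (i + 1) T') 0 + (pathSet T (i + 1)).card * (Real.log m + 1) := by
  have hT := hacc.hT
  rcases i with _ | i
  · refine wingPot_access hacc hmono hm hle hT hacc.hs (fun y => ?_) (fun _ _ => Iff.rfl)
      fun _ _ => rfl
    simp only [remaining, hkT, Finset.mem_Icc]
    omega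
  · obtain ⟨L, R, rfl⟩ := exists_eq_node_of_root? (hroot (by omega))
    have hkR : ∀ y, y ∈ keys R ↔ y ∈ keys (node L (i + 1) R) ∧ i + 1 + 1 ≤ y := by
      intro y
      simp only [keys, Finset.mem_insert, Finset.mem_union]
      constructor
      · intro h
        have := hT.2.1 y h
        exact ⟨by tauto, by omega⟩
      · rintro ⟨h2 | h2 | h2, h3⟩
        · omega
        · have := hT.1 y h2; omega
        · exact h2
    refine wingPot_access hacc hmono hm hle hT.2.2.2 ((hkR _).2 ⟨hacc.hs, le_rfl⟩) hkR
      (fun x hx => ?_) fun a ha => subtree?_node_right hT ha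
    have := hT.2.1 x hx
    simp only [pathList]
    split_ifs with h1 h2
    · omega
    · omega
    · rw [List.mem_cons]
      exact or_iff_right this.ne'

theorem mul_log_le_sequential_cost {n p m : ℕ} (T : ℕ → BTree) (hinit : T 0 = leftPathTree n)
    (hacc : ∀ i < n, IsAccess (T i) (i + 1) (T (i + 1)))
    (hmono : ∀ i < n, MonotoneDecomp (T i) (i + 1) (T (i + 1)) p) (hm : 1 ≤ m)
    (hle : ∀ i < n, p * (afterLeaves (T i) (i + 1) (T (i + 1))).card ≤ m) :
    n * Real.log n ≤
      ((∑ i ∈ Finset.range n, (pathSet (T i) (i + 1)).card : ℕ) : ℝ) * (Real.log m + 1) := by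
  have hk : ∀ i ≤ n, keys (T i) = Finset.Icc 1 n ∧ isBST (T i) ∧
      (i ≠ 0 → root? (T i) = some i) := by
    intro i
    induction i with
    | zero => simp [hinit, keys_leftPathTree, isBST_leftPathTree]
    | succ i ih =>
      intro hi
      have := hacc i hi
      exact ⟨this.hkeys.trans (ih (by omega)).1, this.hT', fun _ => this.hroot⟩
  have hsum : ∀ i ≤ n, wingPot (leftPathTree n) 0 ≤ wingPot (remaining i (T i)) 0 +
      ((∑ j ∈ Finset.range i, (pathSet (T j) (j + 1)).card : ℕ) : ℝ) * (Real.log m + 1) := by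
    intro i
    induction i with
    | zero => simp [hinit, remaining]
    | succ i ih =>
      intro hi
      have h1 := ih (by omega)
      have h2 := hk i (by omega)
      have h3 := wingPot_sequential_access (hacc i hi) h2.1 h2.2.2 (hmono i hi) hm (hle i hi)
      rw [Finset.sum_range_succ]
      push_cast at *
      linarith
  have hend : wingPot (remaining n (T n)) 0 = 0 := by
    suffices remaining n (T n) = nil by simp [this, wingPot]
    obtain ⟨hkn, hbn, hrn⟩ := hk n le_rfl
    rcases n with _ | n
    · exact eq_nil_of_keys_eq_empty (by simpa [remaining] using hkn)
    · obtain ⟨L, R, h⟩ := exists_eq_node_of_root? (hrn (by omega))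
      rw [h] at hkn hbn ⊢
      refine eq_nil_of_keys_eq_empty (Finset.eq_empty_of_forall_notMem fun y hy => ?_)
      have h1 := hbn.2.1 y hy
      have h2 : y ∈ Finset.Icc 1 (n + 1) := hkn ▸ by
        simp only [remaining, rightTree] at hy
        simp [keys, hy]
      rw [Finset.mem_Icc] at h2
      omega
  have := hsum n le_rfl
  rw [hend, wingPot_leftPathTree] at this
  simpa using this

end Paper.BTree

/-- **Theorem (necessity of many leaves).** If, on the sequential access sequence
`1, 2, …, n` starting from the left-leaning path, every after-tree of `Alg` decomposes
into at most `p` monotone sets and has at most `f n = n^{o(1)}` leaves, then the total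
access cost `C(n)` satisfies `C(n)/n → ∞`; in particular `Alg` does not satisfy the
sequential access theorem. -/
theorem necessity_many_leaves (Alg : BTree → ℕ → BTree → Prop)
    (hvalid : ∀ T s T', Alg T s T' → IsAccess T s T')
    (p : ℕ) (f : ℕ → ℕ)
    (hf : Filter.Tendsto (fun n => Real.log (f n) / Real.log n) Filter.atTop (nhds 0))
    (Ts : ℕ → ℕ → BTree)
    (hinit : ∀ n, Ts n 0 = leftPathTree n)
    (hstep : ∀ n, ∀ i < n, Alg (Ts n i) (i + 1) (Ts n (i + 1)))
    (hmono : ∀ n, ∀ i < n, MonotoneDecomp (Ts n i) (i + 1) (Ts n (i + 1)) p)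
    (hleaves : ∀ n, ∀ i < n, (afterLeaves (Ts n i) (i + 1) (Ts n (i + 1))).card ≤ f n) :
    Filter.Tendsto
      (fun n => ((∑ i ∈ Finset.range n, (pathSet (Ts n i) (i + 1)).card : ℕ) : ℝ) / (n : ℝ))
      Filter.atTop Filter.atTop := by
  let b : ℕ → ℝ := fun n => Real.log (p + 1) + 1 + Real.log (f n)
  have hp : 0 ≤ Real.log (p + 1) :=
    Real.log_nonneg (by linarith [(Nat.cast_nonneg p : (0 : ℝ) ≤ p)])
  have hb : ∀ n, 0 < b n := fun n => by
    have := Real.log_natCast_nonneg (f n)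
    simp only [b]
    linarith
  have hcost : ∀ n : ℕ, n * Real.log n ≤
      ((∑ i ∈ Finset.range n, (pathSet (Ts n i) (i + 1)).card : ℕ) : ℝ) * b n := by
    intro n
    have hmax : Real.log ((max (f n) 1 : ℕ) : ℝ) = Real.log (f n) := by
      rcases Nat.eq_zero_or_pos (f n) with h | h
      · simp [h]
      · rw [max_eq_left h]
    have hm : 1 ≤ (p + 1) * max (f n) 1 := Nat.mul_pos (by omega) (by omega)
    have h := mul_log_le_sequential_cost (p := p) (Ts n) (hinit n)
      (fun i hi => hvalid _ _ _ (hstep n i hi)) (hmono n) hm fun i hi =>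
        Nat.mul_le_mul (Nat.le_succ p) ((hleaves n i hi).trans (le_max_left _ _))
    rw [Nat.cast_mul, Real.log_mul (by positivity) (by positivity), hmax] at h
    convert h using 2
    simp only [b]
    push_cast
    ring
  have hlog : Filter.Tendsto (fun n : ℕ => Real.log n) Filter.atTop Filter.atTop :=
    Real.tendsto_log_atTop.comp tendsto_natCast_atTop_atTop
  have hlim : Filter.Tendsto (fun n => b n / Real.log n) Filter.atTop (nhds 0) := by
    have h := (hlog.const_div_atTop (Real.log (p + 1) + 1)).add hf
    rw [add_zero] at h
    exact h.congr fun n => (add_div _ _ _).symm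
  have hpos : ∀ᶠ n : ℕ in Filter.atTop, b n / Real.log n ∈ Set.Ioi (0 : ℝ) := by
    filter_upwards [hlog.eventually_gt_atTop 0] with n hn using div_pos (hb n) hn
  have hinv := (tendsto_nhdsWithin_iff.2 ⟨hlim, hpos⟩).inv_tendsto_nhdsGT_zero
  refine Filter.tendsto_atTop_mono' _ ?_ hinv
  filter_upwards [Filter.eventually_gt_atTop 0] with n hn
  have hn' : (0 : ℝ) < n := by exact_mod_cast hn
  simp only [Pi.inv_apply, inv_div]
  rw [div_le_div_iff₀ (hb n) hn']
  linarith [hcost n]
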